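/- arXiv:2307.10469 — 2 statements merged into one kernel-verified Lean document; each statement's English description precedes it below -/
import Mathlib

section
/- Let E be a finite set, P a finite nonempty set, and for each p ∈ P let a_p ∈ EuclideanSpace ℝ E be a vector all of whose coordinates lie in {0,1}, with at most H nonzero coordinates (H ≥ 1). For γ̃ > 0 define T^γ̃ : EuclideanSpace ℝ E → ℝ by T^γ̃(t) = −γ̃ · ln(Σ_{p∈P} exp(−⟨a_p, t⟩/γ̃)). Then T^γ̃ is differentiable and its gradient is Lipschitz continuous with constant H/γ̃ with respect to the Euclidean norm. (This is the smoothness claim of Theorem 1: T_ij^γ̃ has Lipschitz gradient with constant H_ij/γ̃, where H_ij is the number of edges in the longest path in P_ij.) -/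
open scoped RealInnerProductSpace

/-- Cauchy–Schwarz for the covariance of two bounded functions under a probability weight. -/
theorem abs_covariance_le_mul {P : Type*} [Fintype P] (w x y : P → ℝ)
    (hw : ∀ p, 0 ≤ w p) (hw1 : ∑ p, w p = 1) {A B : ℝ} (hA : 0 ≤ A) (hB : 0 ≤ B)
    (hx : ∀ p, x p ^ 2 ≤ A ^ 2) (hy : ∀ p, y p ^ 2 ≤ B ^ 2) :
    |∑ p, w p * x p * y p - (∑ p, w p * x p) * ∑ p, w p * y p| ≤ A * B := by
  set m := ∑ p, w p * x p with hm
  have second_moment_le (z : P → ℝ) (C : ℝ) (hz : ∀ p, z p ^ 2 ≤ C ^ 2) :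
      ∑ p, w p * z p ^ 2 ≤ C ^ 2 := by
    calc ∑ p, w p * z p ^ 2 ≤ ∑ p, w p * C ^ 2 :=
          Finset.sum_le_sum fun p _ => mul_le_mul_of_nonneg_left (hz p) (hw p)
      _ = C ^ 2 := by rw [← Finset.sum_mul, hw1, one_mul]
  have hcov : ∑ p, w p * x p * y p - m * ∑ p, w p * y p = ∑ p, w p * (x p - m) * y p := by
    rw [Finset.mul_sum, ← Finset.sum_sub_distrib]
    exact Finset.sum_congr rfl fun p _ => by ring
  have hvar : ∑ p, w p * (x p - m) ^ 2 ≤ A ^ 2 := by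
    have h : ∑ p, w p * (x p - m) ^ 2 = ∑ p, w p * x p ^ 2 - m ^ 2 := by
      calc ∑ p, w p * (x p - m) ^ 2
          = ∑ p, (w p * x p ^ 2 - 2 * m * (w p * x p) + m ^ 2 * w p) :=
            Finset.sum_congr rfl fun p _ => by ring
        _ = ∑ p, w p * x p ^ 2 - m ^ 2 := by
            rw [Finset.sum_add_distrib, Finset.sum_sub_distrib, ← Finset.mul_sum,
              ← Finset.mul_sum, hw1, ← hm]
            ring
    have := second_moment_le x A hx
    nlinarith [sq_nonneg m]
  rw [hcov]
  refine abs_le_of_sq_le_sq ?_ (mul_nonneg hA hB)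
  calc (∑ p, w p * (x p - m) * y p) ^ 2
      ≤ (∑ p, w p * (x p - m) ^ 2) * ∑ p, w p * y p ^ 2 :=
        Finset.sum_sq_le_sum_mul_sum_of_sq_le_mul _
          (fun p _ => mul_nonneg (hw p) (sq_nonneg _))
          (fun p _ => mul_nonneg (hw p) (sq_nonneg _)) fun p _ => le_of_eq (by ring)
    _ ≤ A ^ 2 * B ^ 2 :=
        mul_le_mul hvar (second_moment_le y B hy)
          (Finset.sum_nonneg fun p _ => mul_nonneg (hw p) (sq_nonneg _)) (sq_nonneg A)
    _ = (A * B) ^ 2 := by ring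

section Softmin

variable {V P : Type*} [NormedAddCommGroup V] [InnerProductSpace ℝ V] [Fintype P]

/-- The Gibbs weight of `p` at temperature `γ` for the linear costs `⟪a p, t⟫`. -/
noncomputable def gibbsWeight (a : P → V) (γ : ℝ) (t : V) (p : P) : ℝ :=
  Real.exp (-⟪a p, t⟫ / γ) / ∑ q, Real.exp (-⟪a q, t⟫ / γ)

theorem sum_exp_pos [Nonempty P] (f : P → ℝ) : 0 < ∑ p, Real.exp (f p) :=
  Finset.sum_pos (fun _ _ => Real.exp_pos _) Finset.univ_nonempty

theorem gibbsWeight_nonneg (a : P → V) (γ : ℝ) (t : V) (p : P) : 0 ≤ gibbsWeight a γ t p := by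
  unfold gibbsWeight
  positivity

theorem sum_gibbsWeight [Nonempty P] (a : P → V) (γ : ℝ) (t : V) :
    ∑ p, gibbsWeight a γ t p = 1 := by
  simp only [gibbsWeight]
  rw [← Finset.sum_div, div_self (sum_exp_pos _).ne']

theorem hasGradientAt_softmin [CompleteSpace V] [Nonempty P] (a : P → V) {γ : ℝ} (hγ : γ ≠ 0)
    (t : V) :
    HasGradientAt (fun t => -γ * Real.log (∑ p, Real.exp (-⟪a p, t⟫ / γ)))
      (∑ p, gibbsWeight a γ t p • a p) t := by
  rw [hasGradientAt_iff_hasFDerivAt]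
  have hexp (p : P) : HasFDerivAt (fun t => Real.exp (-⟪a p, t⟫ / γ))
      (Real.exp (-⟪a p, t⟫ / γ) • ((-γ⁻¹) • innerSL ℝ (a p))) t := by
    refine HasFDerivAt.exp ?_
    have hfun : (fun t => -⟪a p, t⟫ / γ) = fun t => ((-γ⁻¹) • innerSL ℝ (a p)) t := by
      ext s
      simp [div_eq_inv_mul]
    rw [hfun]
    exact ContinuousLinearMap.hasFDerivAt _
  have hsum := HasFDerivAt.fun_sum (u := Finset.univ) fun p _ => hexp p
  refine ((hsum.log (sum_exp_pos _).ne').const_mul (-γ)).congr_fderiv ?_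
  ext s
  simp only [gibbsWeight, smul_apply, sum_apply, innerSL_apply_apply,
    InnerProductSpace.toDual_apply_apply, sum_inner, real_inner_smul_left, smul_eq_mul,
    Finset.mul_sum]
  refine Finset.sum_congr rfl fun p _ => ?_
  field_simp

/-- Along a line, the Gibbs mean of `y` has derivative `-γ⁻¹` times the Gibbs covariance of `y`
with the costs of the direction. -/
theorem hasDerivAt_gibbsMean [Nonempty P] (a : P → V) {γ : ℝ} (hγ : γ ≠ 0) (s u : V)
    (y : P → ℝ) (r : ℝ) :
    HasDerivAt (fun r : ℝ => ∑ p, gibbsWeight a γ (s + r • u) p * y p)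
      (-γ⁻¹ * (∑ p, gibbsWeight a γ (s + r • u) p * ⟪a p, u⟫ * y p -
        (∑ p, gibbsWeight a γ (s + r • u) p * ⟪a p, u⟫) *
          ∑ p, gibbsWeight a γ (s + r • u) p * y p)) r := by
  have hexp (p : P) : HasDerivAt (fun r : ℝ => Real.exp (-⟪a p, s + r • u⟫ / γ))
      (Real.exp (-⟪a p, s + r • u⟫ / γ) * (-⟪a p, u⟫ / γ)) r := by
    refine HasDerivAt.exp ?_
    simp only [inner_add_right, real_inner_smul_right]
    simpa using ((((hasDerivAt_id r).mul_const ⟪a p, u⟫).const_add ⟪a p, s⟫).neg).div_const γ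
  have hden := HasDerivAt.fun_sum (u := Finset.univ) fun p _ => hexp p
  have hnum := HasDerivAt.fun_sum (u := Finset.univ) fun p _ => (hexp p).mul_const (y p)
  have hpos := sum_exp_pos fun p => -⟪a p, s + r • u⟫ / γ
  have hmean (r : ℝ) (z : P → ℝ) : ∑ p, gibbsWeight a γ (s + r • u) p * z p =
      (∑ p, Real.exp (-⟪a p, s + r • u⟫ / γ) * z p) /
        ∑ p, Real.exp (-⟪a p, s + r • u⟫ / γ) := by
    simp only [gibbsWeight]
    rw [Finset.sum_div]
    exact Finset.sum_congr rfl fun p _ => by ring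
  have hscale (z : P → ℝ) :
      ∑ p, Real.exp (-⟪a p, s + r • u⟫ / γ) * (-⟪a p, u⟫ / γ) * z p =
        -γ⁻¹ * ∑ p, Real.exp (-⟪a p, s + r • u⟫ / γ) * (⟪a p, u⟫ * z p) := by
    rw [Finset.mul_sum]
    exact Finset.sum_congr rfl fun p _ => by ring
  have hscale_one := hscale 1
  simp only [Pi.one_apply, mul_one] at hscale_one
  simp only [mul_assoc (gibbsWeight a γ (s + r • u) _), hmean]
  refine (hnum.fun_div hden hpos.ne').congr_deriv ?_
  rw [hscale, hscale_one]
  field_simp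
  ring

theorem norm_gibbsMean_sub_le [Nonempty P] (a : P → V) {γ : ℝ} (hγ : 0 < γ) {H : ℝ}
    (ha : ∀ p, ‖a p‖ ^ 2 ≤ H) (s t : V) :
    ‖∑ p, gibbsWeight a γ t p • a p - ∑ p, gibbsWeight a γ s p • a p‖ ≤ H / γ * ‖t - s‖ := by
  have hH : 0 ≤ H := (sq_nonneg _).trans (ha (Classical.arbitrary P))
  set v := ∑ p, gibbsWeight a γ t p • a p - ∑ p, gibbsWeight a γ s p • a p with hv
  have hcost (z : V) (p : P) : ⟪a p, z⟫ ^ 2 ≤ (√H * ‖z‖) ^ 2 := by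
    rw [mul_pow, Real.sq_sqrt hH]
    calc ⟪a p, z⟫ ^ 2 ≤ (‖a p‖ * ‖z‖) ^ 2 :=
          sq_le_sq' (neg_le_of_abs_le (abs_real_inner_le_norm _ _)) (real_inner_le_norm _ _)
      _ = ‖a p‖ ^ 2 * ‖z‖ ^ 2 := mul_pow _ _ _
      _ ≤ H * ‖z‖ ^ 2 := mul_le_mul_of_nonneg_right (ha p) (sq_nonneg _)
  have hbound := norm_image_sub_le_of_norm_deriv_le_segment_01'
    (f := fun r : ℝ => ∑ p, gibbsWeight a γ (s + r • (t - s)) p * ⟪a p, v⟫)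
    (C := H / γ * ‖t - s‖ * ‖v‖)
    (fun r _ => (hasDerivAt_gibbsMean a hγ.ne' s (t - s) _ r).hasDerivWithinAt)
    (fun r _ => by
      have hcov := abs_covariance_le_mul (gibbsWeight a γ (s + r • (t - s)))
        (fun p => ⟪a p, t - s⟫) (fun p => ⟪a p, v⟫) (gibbsWeight_nonneg a γ _)
        (sum_gibbsWeight a γ _) (by positivity) (by positivity) (hcost (t - s)) (hcost v)
      rw [norm_mul, norm_neg, norm_inv, Real.norm_of_nonneg hγ.le, Real.norm_eq_abs]
      calc _ ≤ γ⁻¹ * (√H * ‖t - s‖ * (√H * ‖v‖)) :=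
            mul_le_mul_of_nonneg_left hcov (by positivity)
        _ = √H * √H / γ * ‖t - s‖ * ‖v‖ := by ring
        _ = H / γ * ‖t - s‖ * ‖v‖ := by rw [Real.mul_self_sqrt hH])
  have hinner : ∑ p, gibbsWeight a γ t p * ⟪a p, v⟫ - ∑ p, gibbsWeight a γ s p * ⟪a p, v⟫
      = ‖v‖ * ‖v‖ := by
    rw [← real_inner_self_eq_norm_mul_norm]
    nth_rw 3 [hv]
    simp only [inner_sub_left, sum_inner, real_inner_smul_left]
  simp only [one_smul, zero_smul, add_zero, add_sub_cancel, hinner] at hbound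
  rw [Real.norm_of_nonneg (by positivity)] at hbound
  rcases (norm_nonneg v).eq_or_lt with h | h
  · rw [← h]
    positivity
  · exact le_of_mul_le_mul_right hbound h

end Softmin

theorem norm_sq_eq_card_support_of_zero_or_one {E : Type*} [Fintype E] (x : EuclideanSpace ℝ E)
    [DecidablePred fun e => x e ≠ 0] (hx : ∀ e, x e = 0 ∨ x e = 1) :
    ‖x‖ ^ 2 = ((Finset.univ.filter fun e => x e ≠ 0).card : ℝ) := by
  rw [EuclideanSpace.real_norm_sq_eq, Finset.card_filter, Nat.cast_sum]
  refine Finset.sum_congr rfl fun e _ => ?_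
  rcases hx e with h | h <;> simp [h]

/-- Smoothness claim of Theorem 1: the entropic smoothing
`T^γ̃(t) = −γ̃ ln Σ_p exp(−⟨a_p,t⟩/γ̃)` of the shortest-path cost, over 0/1
incidence vectors with at most `H` nonzero entries, is differentiable with
`H/γ̃`-Lipschitz gradient in the Euclidean norm. -/
theorem softmin_gradient_lipschitz {E P : Type*} [Fintype E] [Fintype P] [Nonempty P]
    (a : P → EuclideanSpace ℝ E)
    (ha01 : ∀ p e, a p e = 0 ∨ a p e = 1)
    (H : ℝ) (hH : 1 ≤ H)
    (haH : ∀ p, ((Finset.univ.filter (fun e => a p e ≠ 0)).card : ℝ) ≤ H)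
    (γ : ℝ) (hγ : 0 < γ)
    (T : EuclideanSpace ℝ E → ℝ)
    (hT : ∀ t, T t = -γ * Real.log (∑ p : P, Real.exp (-⟪a p, t⟫ / γ))) :
    Differentiable ℝ T ∧
    LipschitzWith (Real.toNNReal (H / γ)) (fun t => gradient T t) := by
  have hgrad (t : EuclideanSpace ℝ E) :
      HasGradientAt T (∑ p, gibbsWeight a γ t p • a p) t := by
    rw [funext hT]
    exact hasGradientAt_softmin a hγ.ne' t
  have ha (p : P) : ‖a p‖ ^ 2 ≤ H :=
    (norm_sq_eq_card_support_of_zero_or_one (a p) (ha01 p)).trans_le (haH p)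
  refine ⟨fun t => (hgrad t).differentiableAt, LipschitzWith.of_dist_le_mul fun t s => ?_⟩
  rw [Real.coe_toNNReal _ (by positivity), dist_eq_norm, dist_eq_norm, (hgrad t).gradient,
    (hgrad s).gradient]
  exact norm_gibbsMean_sub_le a hγ ha s t
end

section
/- Let O and D be finite nonempty sets, OD a nonempty subset of O × D, γ > 0, T : OD → ℝ, l : O → ℝ, w : D → ℝ. Suppose d : OD → ℝ satisfies d_{ij} ≥ 0, Σ_{j : (i,j)∈OD} d_{ij} = l_i for all i, Σ_{i : (i,j)∈OD} d_{ij} = w_j for all j, and Σ_{(i,j)∈OD} d_{ij} = 1. Then for all λ : O → ℝ and μ : D → ℝ (weak duality for the entropy-regularized transport problem): Σ_{(i,j)∈OD} d_{ij} T_{ij} + γ · Σ_{(i,j)∈OD} d_{ij} ln d_{ij} ≥ Σ_i l_i λ_i + Σ_j w_j μ_j − γ · ln(Σ_{(i,j)∈OD} exp((−T_{ij} + λ_i + μ_j)/γ)) (with the convention 0 · ln 0 = 0). -/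
/-- Gibbs variational inequality: for a probability vector `p` on `s`, the mean of `x` minus the
negative entropy `∑ p log p` is at most the log-sum-exp of `x`. -/
theorem sum_mul_le_sum_mul_log_add_log_sum_exp {ι : Type*} (s : Finset ι) (p x : ι → ℝ)
    (hp : ∀ i ∈ s, 0 ≤ p i) (hp1 : ∑ i ∈ s, p i = 1) :
    ∑ i ∈ s, p i * x i ≤
      ∑ i ∈ s, p i * Real.log (p i) + Real.log (∑ i ∈ s, Real.exp (x i)) := by
  set Z := ∑ i ∈ s, Real.exp (x i) with hZ
  have hs : s.Nonempty := Finset.nonempty_of_sum_ne_zero (hp1.trans_ne one_ne_zero)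
  have hZpos : 0 < Z := Finset.sum_pos (fun i _ => Real.exp_pos _) hs
  have pointwise : ∀ i ∈ s,
      p i * x i ≤ p i * Real.log (p i) + p i * Real.log Z + (Real.exp (x i) / Z - p i) := by
    intro i hi
    rcases (hp i hi).eq_or_lt with h0 | hpos
    · rw [← h0]
      simpa using div_nonneg (Real.exp_pos (x i)).le hZpos.le
    · have h := mul_le_mul_of_nonneg_left
        (Real.add_one_le_exp (x i - Real.log Z - Real.log (p i))) hpos.le
      rw [Real.exp_sub, Real.exp_sub, Real.exp_log hZpos, Real.exp_log hpos,
        mul_div_cancel₀ _ hpos.ne'] at h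
      linarith
  have h := Finset.sum_le_sum pointwise
  rw [Finset.sum_add_distrib, Finset.sum_add_distrib, Finset.sum_sub_distrib, ← Finset.sum_mul,
    ← Finset.sum_div, ← hZ, div_self hZpos.ne', hp1] at h
  linarith

/-- Pairing the pushforward of `d` along `f` with `g` is pairing `d` with `g ∘ f`. -/
theorem sum_fiberwise_mul_eq {ι κ : Type*} [Fintype κ] [DecidableEq κ] (s : Finset ι) (f : ι → κ)
    (d : ι → ℝ) (g : κ → ℝ) :
    ∑ k, (∑ i ∈ s.filter (fun i => f i = k), d i) * g k = ∑ i ∈ s, d i * g (f i) := by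
  rw [← Finset.sum_fiberwise s f fun i => d i * g (f i)]
  refine Finset.sum_congr rfl fun k _ => ?_
  rw [Finset.sum_mul]
  refine Finset.sum_congr rfl fun i hi => ?_
  rw [(Finset.mem_filter.mp hi).2]


/-- Weak duality for the entropy-regularized transport problem: any feasible
correspondence matrix `d` with marginals `l`, `w` has entropic cost at least the
dual objective value, for any multipliers `λ`, `μ`. -/
theorem entropic_transport_weak_duality {O D : Type*} [Fintype O] [Fintype D] [DecidableEq O] [DecidableEq D]
    [Nonempty O] [Nonempty D]
    (OD : Finset (O × D)) (hOD : OD.Nonempty)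
    (γ : ℝ) (hγ : 0 < γ) (T : O × D → ℝ) (l : O → ℝ) (w : D → ℝ)
    (d : O × D → ℝ) (hd0 : ∀ q ∈ OD, 0 ≤ d q)
    (hdl : ∀ i, ∑ q ∈ OD.filter (fun q => q.1 = i), d q = l i)
    (hdw : ∀ j, ∑ q ∈ OD.filter (fun q => q.2 = j), d q = w j)
    (hd1 : ∑ q ∈ OD, d q = 1)
    (lam : O → ℝ) (mu : D → ℝ) :
    ∑ q ∈ OD, d q * T q + γ * ∑ q ∈ OD, d q * Real.log (d q) ≥
      ∑ i, l i * lam i + ∑ j, w j * mu j -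
        γ * Real.log (∑ q ∈ OD, Real.exp ((-T q + lam q.1 + mu q.2) / γ)) := by
  have hl : ∑ i, l i * lam i = ∑ q ∈ OD, d q * lam q.1 := by
    simp_rw [← hdl]
    exact sum_fiberwise_mul_eq OD Prod.fst d lam
  have hw : ∑ j, w j * mu j = ∑ q ∈ OD, d q * mu q.2 := by
    simp_rw [← hdw]
    exact sum_fiberwise_mul_eq OD Prod.snd d mu
  have gibbs := mul_le_mul_of_nonneg_left
    (sum_mul_le_sum_mul_log_add_log_sum_exp OD d
      (fun q => (-T q + lam q.1 + mu q.2) / γ) hd0 hd1) hγ.le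
  have hsum : γ * ∑ q ∈ OD, d q * ((-T q + lam q.1 + mu q.2) / γ) =
      ∑ q ∈ OD, d q * lam q.1 + ∑ q ∈ OD, d q * mu q.2 - ∑ q ∈ OD, d q * T q := by
    rw [Finset.mul_sum, ← Finset.sum_add_distrib, ← Finset.sum_sub_distrib]
    refine Finset.sum_congr rfl fun q _ => ?_
    field_simp
    ring
  rw [hsum] at gibbs
  rw [hl, hw]
  linarith
end
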